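/- arXiv:1605.07353 — 6 statements merged into one kernel-verified Lean document; each statement's English description precedes it below -/
import Mathlib

section
/- Consider a tandem of nodes 1,…,M and a finite set I of flows, where each flow i traverses the consecutive nodes of an interval path_i ⊆ {1,…,M} starting at node first_i. For each flow i and each node l ∈ path_i, let F_i^l and F_i^{l,*} be continuous cumulative input and output functions of flow i at node l, with F_i^{l,*} ≤ F_i^l pointwise and F_i^{l+1} = F_i^{l,*} whenever l and l+1 both lie in path_i. Assume each node l offers to the aggregate of the flows crossing it a strict service curve of rate-latency type β_{R^l,T^l} with R^l > 0 and T^l ≥ 0, i.e., for every backlogged period (s,t] of the pair (∑_{i: l∈path_i} F_i^l, ∑_{i: l∈path_i} F_i^{l,*}), one has ∑_{i: l∈path_i} (F_i^{l,*}(t) − F_i^{l,*}(s)) ≥ β_{R^l,T^l}(t−s). Fix a flow of interest f and an integer n with 1 ≤ n ≤ |path_f|, and let subpath_f(n) = {first_f, first_f+1, …, first_f+n−1}; let K_f(n) be the set of flows i ≠ f with path_i ∩ subpath_f(n) ≠ ∅. Assume every i ∈ K_f(n) satisfies first_i ∈ subpath_f(n) and is (σ_i^0, ρ_i)-leaky-bucket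 constrained at its input to node first_i, with σ_i^0 ≥ 0 and ρ_i ≥ 0. Assume R := min_{k ∈ subpath_f(n)} (R^k − ∑_{j ≠ f: k ∈ path_j} ρ_j) > 0. Then the concatenation of the nodes of subpath_f(n) offers to flow f — with input F_f^{first_f} and output F_f^{first_f+n−1,*} — the simple service curve β_{R,T}, where T = ∑_{k ∈ subpath_f(n)} T^k + ∑_{i ∈ K_f(n)} (σ_i^0 + ρ_i · ∑_{j ∈ subpath_f(n) ∩ path_i} T^j) / R. -/
/-- A cumulative function: non-decreasing and zero for all `t ≤ 0`. -/
def Cumulative (F : ℝ → ℝ) : Prop := Monotone F ∧ ∀ t : ℝ, t ≤ 0 → F t = 0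

/-- `α` is an arrival curve for `F`: `F t - F s ≤ α (t - s)` for all `0 ≤ s ≤ t`. -/
def ArrivalCurve (α F : ℝ → ℝ) : Prop := ∀ s t : ℝ, 0 ≤ s → s ≤ t → F t - F s ≤ α (t - s)

/-- The leaky-bucket arrival curve `u ↦ σ + ρ·u`. -/
def leakyBucket (σ ρ : ℝ) : ℝ → ℝ := fun u => σ + ρ * u

/-- The rate-latency function `u ↦ R·max (u - T) 0`. -/
def rateLatency (R T : ℝ) : ℝ → ℝ := fun u => R * max (u - T) 0

/-- The system with input `F`, output `Fs` offers the simple service curve `β`: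
`Fs t ≥ inf_{0 ≤ s ≤ t} (F s + β (t - s))` for all `t ≥ 0`. -/
def OffersSimple (F Fs β : ℝ → ℝ) : Prop :=
  ∀ t : ℝ, 0 ≤ t → sInf ((fun s => F s + β (t - s)) '' Set.Icc 0 t) ≤ Fs t

/-- `(s, t]` is a backlogged period of `(F, Fs)`: `F u > Fs u` for all `s < u ≤ t`. -/
def Backlogged (F Fs : ℝ → ℝ) (s t : ℝ) : Prop :=
  s < t ∧ ∀ u : ℝ, s < u → u ≤ t → Fs u < F u

/-- The system with input `F`, output `Fs` offers the strict service curve `β`. -/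
def OffersStrict (F Fs β : ℝ → ℝ) : Prop :=
  ∀ s t : ℝ, Backlogged F Fs s t → β (t - s) ≤ Fs t - Fs s

lemma aux_backlog_start (A B : ℝ → ℝ) (hA : Continuous A) (hB : Continuous B)
    (h0 : A 0 = B 0) (hBA : ∀ x, B x ≤ A x) (u : ℝ) (hu : 0 ≤ u) :
    ∃ s, 0 ≤ s ∧ s ≤ u ∧ A s = B s ∧ ∀ v, s < v → v ≤ u → B v < A v := by
  have hc : IsCompact (Set.Icc 0 u ∩ {x | A x = B x}) :=
    isCompact_Icc.inter_right (isClosed_eq hA hB)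
  obtain ⟨s, ⟨⟨hs0, hsu⟩, hs⟩, hub⟩ := hc.exists_isGreatest ⟨0, ⟨le_refl _, hu⟩, h0⟩
  refine ⟨s, hs0, hsu, hs, fun v hv hvu => lt_of_le_of_ne (hBA v) fun h => ?_⟩
  exact absurd (hub ⟨⟨hs0.trans hv.le, hvu⟩, h.symm⟩) (not_le.mpr hv)

lemma aux_times (P : ℕ → ℝ → ℝ → Prop) (a n : ℕ)
    (h : ∀ k, a ≤ k → k < a + n → ∀ u, 0 ≤ u → ∃ s, 0 ≤ s ∧ s ≤ u ∧ P k s u)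
    (t : ℝ) (ht : 0 ≤ t) :
    ∃ τ : ℕ → ℝ, τ (a + n) = t ∧ ∀ k, a ≤ k → k < a + n →
      0 ≤ τ k ∧ τ k ≤ τ (k + 1) ∧ P k (τ k) (τ (k + 1)) := by
  induction n generalizing t with
  | zero => exact ⟨fun _ => t, rfl, fun k h1 h2 => by omega⟩
  | succ n ih =>
    obtain ⟨s, hs0, hst, hP⟩ := h (a + n) (by omega) (by omega) t ht
    obtain ⟨τ, hτ, hτP⟩ := ih (fun k h1 h2 => h k h1 (by omega)) s hs0
    refine ⟨fun k => if k = a + (n + 1) then t else τ k, by simp, fun k h1 h2 => ?_⟩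
    have e1 : k ≠ a + (n + 1) := by omega
    by_cases hk : k = a + n
    · subst hk
      have e2 : a + n + 1 = a + (n + 1) := by omega
      simp only [e1, e2, if_true, if_false, hτ]
      exact ⟨hs0, hst, hP⟩
    · have e2 : k + 1 ≠ a + (n + 1) := by omega
      simp only [e1, e2, if_false]
      exact hτP k h1 (by omega)

lemma aux_telescope (G Gs : ℕ → ℝ → ℝ) (τ : ℕ → ℝ) (b L c : ℕ) (hbc : b ≤ c)
    (hlink : ∀ l, b ≤ l → l + 1 < b + L → G (l + 1) = Gs l) (hc : c < b + L) :
    ∑ k ∈ Finset.Ico b (c + 1), (Gs k (τ (k + 1)) - G k (τ k))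
      = Gs c (τ (c + 1)) - G b (τ b) := by
  induction c, hbc using Nat.le_induction with
  | base => simp
  | succ c hbc ih =>
    rw [Finset.sum_Ico_succ_top (by omega), ih (by omega), hlink c hbc hc]
    ring

lemma aux_out_le (G Gs : ℕ → ℝ → ℝ) (b L c : ℕ) (hbc : b ≤ c)
    (hlink : ∀ l, b ≤ l → l + 1 < b + L → G (l + 1) = Gs l)
    (hle : ∀ l, b ≤ l → l < b + L → ∀ t, Gs l t ≤ G l t) (hc : c < b + L) (t : ℝ) :
    Gs c t ≤ G b t := by
  induction c, hbc using Nat.le_induction with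
  | base => exact hle b le_rfl hc t
  | succ c hbc ih =>
    refine (hle _ (by omega) hc t).trans ?_
    rw [hlink c hbc hc]
    exact ih (by omega)

/-- Lemma 1 (end-to-end service curve in a tandem network under arbitrary
multiplexing, "Pay Multiplex Only Once"): the concatenation of the nodes of
`subpath_f(n)` offers flow `f` the rate-latency simple service curve with rate
`R = min_{k ∈ subpath_f(n)} (R^k - ∑_{j ≠ f : k ∈ path_j} ρ_j)` and latency
`T = ∑_{k} T^k + ∑_{i ∈ K_f(n)} (σ_i^0 + ρ_i ∑_{j ∈ subpath_f(n) ∩ path_i} T^j) / R`. -/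
theorem tandem_pmoo_service_curve
    {I : Type*} [Fintype I] [DecidableEq I]
    (M : ℕ)
    (first len : I → ℕ) (hlen : ∀ i, 1 ≤ len i)
    (path : I → Finset ℕ)
    (hpath : ∀ i, path i = Finset.Ico (first i) (first i + len i))
    (hpathSub : ∀ i, path i ⊆ Finset.Icc 1 M)
    -- cumulative input/output functions of flow `i` at node `l`
    (F Fs : I → ℕ → ℝ → ℝ)
    (hFcum : ∀ i, ∀ l ∈ path i, Cumulative (F i l) ∧ Continuous (F i l))
    (hFscum : ∀ i, ∀ l ∈ path i, Cumulative (Fs i l) ∧ Continuous (Fs i l))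
    (hle : ∀ i, ∀ l ∈ path i, ∀ t : ℝ, Fs i l t ≤ F i l t)
    (hlink : ∀ i, ∀ l : ℕ, l ∈ path i → l + 1 ∈ path i → F i (l + 1) = Fs i l)
    -- each node offers a strict rate-latency service curve to its aggregate
    (Rn Tn : ℕ → ℝ)
    (hRn : ∀ l ∈ Finset.Icc 1 M, 0 < Rn l)
    (hTn : ∀ l ∈ Finset.Icc 1 M, 0 ≤ Tn l)
    (hstrict : ∀ l ∈ Finset.Icc 1 M,
      OffersStrict
        (fun t => ∑ i ∈ Finset.univ.filter (fun i => l ∈ path i), F i l t)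
        (fun t => ∑ i ∈ Finset.univ.filter (fun i => l ∈ path i), Fs i l t)
        (rateLatency (Rn l) (Tn l)))
    -- flow of interest and its subpath of length n
    (f : I) (n : ℕ) (hn1 : 1 ≤ n) (hn2 : n ≤ len f)
    (subpath : Finset ℕ) (hsubpath : subpath = Finset.Ico (first f) (first f + n))
    -- the set of interfering flows
    (K : Finset I) (hK : ∀ i, i ∈ K ↔ i ≠ f ∧ (path i ∩ subpath).Nonempty)
    -- leaky-bucket constraints on interfering flows, entering on the subpath
    (σ ρ : I → ℝ)
    (hσ : ∀ i ∈ K, 0 ≤ σ i) (hρ : ∀ i ∈ K, 0 ≤ ρ i)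
    (hfirstIn : ∀ i ∈ K, first i ∈ subpath)
    (harr : ∀ i ∈ K, ArrivalCurve (leakyBucket (σ i) (ρ i)) (F i (first i)))
    -- the residual rate and the end-to-end latency
    (Rmin : ℝ)
    (hRmin : Rmin = sInf
      ((fun k => Rn k - ∑ j ∈ Finset.univ.filter (fun j => j ≠ f ∧ k ∈ path j), ρ j) ''
        (subpath : Set ℕ)))
    (hRpos : 0 < Rmin)
    (Ttot : ℝ)
    (hTtot : Ttot = (∑ k ∈ subpath, Tn k) +
      ∑ i ∈ K, (σ i + ρ i * ∑ j ∈ subpath ∩ path i, Tn j) / Rmin) :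
    OffersSimple (F f (first f)) (Fs f (first f + n - 1)) (rateLatency Rmin Ttot) := by
  intro t ht
  have hmem : ∀ i l, l ∈ path i ↔ first i ≤ l ∧ l < first i + len i := by
    intro i l; rw [hpath, Finset.mem_Ico]
  have hsm : ∀ l, l ∈ subpath ↔ first f ≤ l ∧ l < first f + n := by
    intro l; rw [hsubpath, Finset.mem_Ico]
  have hfp : ∀ k ∈ subpath, k ∈ path f := by
    intro k hk; rw [hsm] at hk; rw [hmem]; omega
  have hsM : ∀ k ∈ subpath, k ∈ Finset.Icc 1 M := fun k hk => hpathSub f (hfp k hk)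
  -- the sequence of times
  obtain ⟨τ, hτe, hτ⟩ := aux_times (fun k s u =>
      (∀ i, k ∈ path i → F i k s = Fs i k s) ∧
      rateLatency (Rn k) (Tn k) (u - s) ≤
        (∑ i ∈ Finset.univ.filter (fun i => k ∈ path i), Fs i k u) -
        ∑ i ∈ Finset.univ.filter (fun i => k ∈ path i), Fs i k s)
    (first f) n (by
      intro k h1 h2 u hu
      have hks : k ∈ subpath := (hsm k).2 ⟨h1, h2⟩
      obtain ⟨s, hs0, hsu, hs, hb⟩ := aux_backlog_start
        (fun t => ∑ i ∈ Finset.univ.filter (fun i => k ∈ path i), F i k t)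
        (fun t => ∑ i ∈ Finset.univ.filter (fun i => k ∈ path i), Fs i k t)
        (continuous_finsetSum _ fun i hi => (hFcum i k (Finset.mem_filter.1 hi).2).2)
        (continuous_finsetSum _ fun i hi => (hFscum i k (Finset.mem_filter.1 hi).2).2)
        (Finset.sum_congr rfl fun i hi => by
          rw [(hFcum i k (Finset.mem_filter.1 hi).2).1.2 0 le_rfl,
            (hFscum i k (Finset.mem_filter.1 hi).2).1.2 0 le_rfl])
        (fun x => Finset.sum_le_sum fun i hi => hle i k (Finset.mem_filter.1 hi).2 x)
        u hu
      refine ⟨s, hs0, hsu, ?_, ?_⟩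
      · intro i hi
        have := (Finset.sum_eq_sum_iff_of_le (f := fun i => Fs i k s) (g := fun i => F i k s)
          (fun i hi => hle i k (Finset.mem_filter.1 hi).2 s)).1 hs.symm i
          (Finset.mem_filter.2 ⟨Finset.mem_univ _, hi⟩)
        exact this.symm
      · rcases hsu.eq_or_lt with h | h
        · subst h
          have := hTn k (hsM k hks)
          simp [rateLatency, this]
        · exact hstrict k (hsM k hks) s u ⟨h, hb⟩) t ht
  have hτm : ∀ b c, first f ≤ b → b ≤ c → c ≤ first f + n → τ b ≤ τ c := by
    intro b c hb hbc
    induction c, hbc using Nat.le_induction with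
    | base => intro _; exact le_rfl
    | succ c hbc ih =>
      intro hc
      exact (ih (by omega)).trans (hτ c (by omega) (by omega)).2.1
  have hτd : ∀ b c, b ≤ c → ∑ k ∈ Finset.Ico b c, (τ (k + 1) - τ k) = τ c - τ b := by
    intro b c hbc
    exact Finset.sum_Ico_sub τ hbc
  have hlink' : ∀ i l, first i ≤ l → l + 1 < first i + len i → F i (l + 1) = Fs i l := by
    intro i l h1 h2
    exact hlink i l ((hmem i l).2 ⟨h1, by omega⟩) ((hmem i _).2 ⟨by omega, h2⟩)
  have hle' : ∀ i l, first i ≤ l → l < first i + len i → ∀ t, Fs i l t ≤ F i l t :=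
    fun i l h1 h2 => hle i l ((hmem i l).2 ⟨h1, h2⟩)
  -- telescoping for f
  have htelf : ∑ k ∈ subpath, (Fs f k (τ (k + 1)) - F f k (τ k))
      = Fs f (first f + n - 1) t - F f (first f) (τ (first f)) := by
    have := aux_telescope (F f) (Fs f) τ (first f) (len f) (first f + n - 1) (by omega)
      (hlink' f) (by omega)
    have e : first f + n - 1 + 1 = first f + n := by omega
    rw [e, hτe] at this
    rw [hsubpath, this]
  -- telescoping for the cross flows
  have htelK : ∀ j ∈ K, ∑ k ∈ subpath ∩ path j, (Fs j k (τ (k + 1)) - F j k (τ k))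
      ≤ σ j + ρ j * ∑ k ∈ subpath ∩ path j, (τ (k + 1) - τ k) := by
    intro j hj
    have hfi := (hsm _).1 (hfirstIn j hj)
    have hl := hlen j
    obtain ⟨c, hc1, hc2, hc3, hc⟩ : ∃ c, first j ≤ c ∧ c < first j + len j ∧ c < first f + n ∧
        subpath ∩ path j = Finset.Ico (first j) (c + 1) := by
      refine ⟨min (first j + len j) (first f + n) - 1, by omega, by omega, by omega, ?_⟩
      ext l
      rw [Finset.mem_inter, hsm, hmem, Finset.mem_Ico]
      omega
    rw [hc, aux_telescope (F j) (Fs j) τ (first j) (len j) c hc1 (hlink' j) hc2,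
      hτd _ _ (by omega)]
    have h1 := aux_out_le (F j) (Fs j) (first j) (len j) c hc1 (hlink' j) (hle' j) hc2 (τ (c + 1))
    have h2 := harr j hj (τ (first j)) (τ (c + 1)) (hτ _ hfi.1 hfi.2).1
      (hτm _ _ hfi.1 (by omega) (by omega))
    simp only [leakyBucket] at h2
    linarith
  have hswap : ∀ X : I → ℕ → ℝ,
      ∑ k ∈ subpath, ∑ j ∈ Finset.univ.filter (fun j => j ≠ f ∧ k ∈ path j), X j k
        = ∑ j ∈ K, ∑ k ∈ subpath ∩ path j, X j k := by
    intro X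
    apply Finset.sum_comm'
    intro k j
    simp only [Finset.mem_filter, Finset.mem_univ, true_and, Finset.mem_inter, hK]
    constructor
    · rintro ⟨h1, h2, h3⟩
      exact ⟨⟨h1, h3⟩, h2, k, Finset.mem_inter.2 ⟨h3, h1⟩⟩
    · rintro ⟨⟨h1, h3⟩, h2, _⟩
      exact ⟨h1, h2, h3⟩
  -- node inequality
  have hnode : ∀ k ∈ subpath,
      Rmin * (τ (k + 1) - τ k - Tn k)
        + ∑ j ∈ Finset.univ.filter (fun j => j ≠ f ∧ k ∈ path j),
            (ρ j * (τ (k + 1) - τ k) - ρ j * Tn k)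
        - ∑ j ∈ Finset.univ.filter (fun j => j ≠ f ∧ k ∈ path j),
            (Fs j k (τ (k + 1)) - F j k (τ k))
      ≤ Fs f k (τ (k + 1)) - F f k (τ k) := by
    intro k hk
    have hk' := (hsm k).1 hk
    obtain ⟨-, hmono, heq, hsc⟩ := hτ k hk'.1 hk'.2
    have hset : Finset.univ.filter (fun i => k ∈ path i)
        = insert f (Finset.univ.filter (fun j => j ≠ f ∧ k ∈ path j)) := by
      ext i
      simp only [Finset.mem_filter, Finset.mem_univ, true_and, Finset.mem_insert]
      by_cases h : i = f
      · subst h; simp [hfp k hk]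
      · simp [h]
    have hnot : f ∉ Finset.univ.filter (fun j => j ≠ f ∧ k ∈ path j) := by simp
    rw [hset, Finset.sum_insert hnot, Finset.sum_insert hnot] at hsc
    have hFe : ∑ j ∈ Finset.univ.filter (fun j => j ≠ f ∧ k ∈ path j), Fs j k (τ k)
        = ∑ j ∈ Finset.univ.filter (fun j => j ≠ f ∧ k ∈ path j), F j k (τ k) :=
      Finset.sum_congr rfl fun j hj => (heq j (Finset.mem_filter.1 hj).2.2).symm
    rw [hFe, ← heq f (hfp k hk)] at hsc
    have hR : Rmin ≤ Rn k - ∑ j ∈ Finset.univ.filter (fun j => j ≠ f ∧ k ∈ path j), ρ j := by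
      rw [hRmin]
      exact csInf_le ((subpath.finite_toSet.image _).bddBelow) ⟨k, hk, rfl⟩
    have hρs : 0 ≤ ∑ j ∈ Finset.univ.filter (fun j => j ≠ f ∧ k ∈ path j), ρ j := by
      apply Finset.sum_nonneg
      intro j hj
      have := (Finset.mem_filter.1 hj).2
      exact hρ j ((hK j).2 ⟨this.1, k, Finset.mem_inter.2 ⟨this.2, hk⟩⟩)
    rw [Finset.sum_sub_distrib, Finset.sum_sub_distrib, ← Finset.sum_mul, ← Finset.sum_mul]
    simp only [rateLatency] at hsc
    set S := ∑ j ∈ Finset.univ.filter (fun j => j ≠ f ∧ k ∈ path j), ρ j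
    set x := τ (k + 1) - τ k - Tn k with hx
    have hxm : x ≤ max x 0 := le_max_left _ _
    have hm0 : 0 ≤ max x 0 := le_max_right _ _
    have i1 : (Rmin + S) * x ≤ (Rmin + S) * max x 0 :=
      mul_le_mul_of_nonneg_left hxm (by linarith)
    have i2 : (Rmin + S) * max x 0 ≤ Rn k * max x 0 :=
      mul_le_mul_of_nonneg_right (by linarith) hm0
    have i3 : (Rmin + S) * x = Rmin * x + (S * (τ (k + 1) - τ k) - S * Tn k) := by
      rw [hx]; ring
    linarith
  have hsum := Finset.sum_le_sum hnode
  rw [htelf, Finset.sum_sub_distrib, Finset.sum_add_distrib, hswap (fun j k => (ρ j * (τ (k + 1) - τ k) - ρ j * Tn k)),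
    hswap (fun j k => (Fs j k (τ (k + 1)) - F j k (τ k))), ← Finset.mul_sum,
    Finset.sum_sub_distrib (s := subpath)] at hsum
  have hts : ∑ k ∈ subpath, (τ (k + 1) - τ k) = t - τ (first f) := by
    rw [hsubpath, hτd _ _ (by omega), hτe]
  rw [hts] at hsum
  have hKsum := Finset.sum_le_sum htelK
  have hKe : ∑ j ∈ K, ∑ k ∈ subpath ∩ path j, (ρ j * (τ (k + 1) - τ k) - ρ j * Tn k)
      = ∑ j ∈ K, (σ j + ρ j * ∑ k ∈ subpath ∩ path j, (τ (k + 1) - τ k))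
        - ∑ j ∈ K, (σ j + ρ j * ∑ k ∈ subpath ∩ path j, Tn k) := by
    rw [← Finset.sum_sub_distrib]
    refine Finset.sum_congr rfl fun j _ => ?_
    rw [Finset.sum_sub_distrib, ← Finset.mul_sum, ← Finset.mul_sum]
    ring
  have hRT : Rmin * Ttot = Rmin * (∑ k ∈ subpath, Tn k)
      + ∑ j ∈ K, (σ j + ρ j * ∑ k ∈ subpath ∩ path j, Tn k) := by
    rw [hTtot, ← Finset.sum_div, mul_add, mul_div_cancel₀ _ hRpos.ne']
  have hmain : Rmin * (t - τ (first f) - Ttot)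
      ≤ Fs f (first f + n - 1) t - F f (first f) (τ (first f)) := by
    have e : Rmin * (t - τ (first f) - Ttot) = Rmin * (t - τ (first f)) - Rmin * Ttot := by ring
    have e2 : Rmin * (t - τ (first f) - ∑ k ∈ subpath, Tn k)
      = Rmin * (t - τ (first f)) - Rmin * ∑ k ∈ subpath, Tn k := by ring
    linarith
  have hnn : 0 ≤ Fs f (first f + n - 1) t - F f (first f) (τ (first f)) := by
    rw [← htelf]
    apply Finset.sum_nonneg
    intro k hk
    have hk' := (hsm k).1 hk
    obtain ⟨-, hmono, heq, -⟩ := hτ k hk'.1 hk'.2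
    rw [heq f (hfp k hk)]
    exact sub_nonneg.2 ((hFscum f k (hfp k hk)).1.1 hmono)
  have h0 := (hτ (first f) le_rfl (by omega)).1
  have hle_t : τ (first f) ≤ t := by
    rw [← hτe]; exact hτm _ _ le_rfl (by omega) le_rfl
  have hff : first f ∈ path f := (hmem f _).2 ⟨le_rfl, by omega⟩
  refine csInf_le_of_le (b := F f (first f) (τ (first f)) + rateLatency Rmin Ttot (t - τ (first f)))
    ⟨0, ?_⟩ ⟨τ (first f), ⟨h0, hle_t⟩, rfl⟩ ?_
  · rintro _ ⟨s, ⟨hs0, -⟩, rfl⟩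
    have hc := (hFcum f _ hff).1
    have h1 : 0 ≤ F f (first f) s := by
      rw [← hc.2 0 le_rfl]; exact hc.1 hs0
    exact add_nonneg h1 (mul_nonneg hRpos.le (le_max_right _ _))
  · simp only [rateLatency]
    rcases le_total (t - τ (first f) - Ttot) 0 with h | h
    · rw [max_eq_right h]; linarith
    · rw [max_eq_left h]; linarith
end

section
/- Consider a unidirectional ring of M nodes labelled 0,…,M−1, with l ⊕ k := (l+k) mod M and l ⊖ k := (l−k) mod M, and a finite set I of flows, where each flow i traverses the consecutive ring nodes path_i = (first_i, first_i⊕1, …, first_i⊕(h_i−1)) with 1 ≤ h_i ≤ M. For each flow i and each node l ∈ path_i, let F_i^l and F_i^{l,*} be continuous cumulative input and output functions of flow i at node l, with F_i^{l,*} ≤ F_i^l pointwise and F_i^{l⊕1} = F_i^{l,*} whenever l and l⊕1 are consecutive nodes of path_i. Assume each node l offers to the aggregate of the flows crossing it a strict service curve of rate-latency type β_{R^l,T^l} with R^l > 0 and T^l ≥ 0, i.e., for every backlogged period (s,t] of the pair (∑_{i: l∈path_i} F_i^l, ∑_{i: l∈path_i} F_i^{l,*}), one has ∑_{i: l∈path_i}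 (F_i^{l,*}(t) − F_i^{l,*}(s)) ≥ β_{R^l,T^l}(t−s). Fix a flow of interest f and an integer n with 1 ≤ n ≤ h_f, let subpath_f(n) = (first_f, …, first_f⊕(n−1)), and let K_f(n) be the set of flows i ≠ f with path_i ∩ subpath_f(n) ≠ ∅. Assume: (a) every flow i ∈ K_f(n) whose source node first_i lies on subpath_f(n) is (σ_i^0, ρ_i)-leaky-bucket constrained at its input to node first_i; (b) every flow i ∈ K_f(n) that crosses node first_f with first_i ≠ first_f is (σ_i^{first_f⊖1}, ρ_i)-leaky-bucket constrained at its input to node first_f; all bursts are ≥ 0 and all rates ρ_i ≥ 0. Assume R := min_{k ∈ subpath_f(n)} (R^k − ∑_{j ≠ f: k ∈ path_j} ρ_j) > 0. Then the concatenation of the nodes of subpath_f(n) offers to flow f — with input F_f^{first_f} and output F_f^{first_f⊕(n−1),*} — the simple service curve β_{R,T}, where T = ∑_{k ∈ subpath_f(n)} T^k + ∑_{i ∈ K_f(n)} ( σ_i^{first_f⊖1}·𝟙{i crosses first_f and first_i ≠ first_f} + σ_i^0·𝟙{first_i ∈ subpath_f(n)} + ρ_i · ∑_{j ∈ subpath_f(n)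 ∩ path_i} T^j ) / R. -/
theorem seg_bound (n : ℕ) (mem : ℕ → Prop) [DecidablePred mem] (A B : ℕ → ℝ → ℝ)
    (t : ℕ → ℝ) (c : ℕ → ℝ) (ρ : ℝ)
    (h0 : 0 ≤ t 0) (hmono : ∀ k < n, t k ≤ t (k + 1))
    (hc : ∀ k, 0 ≤ c k)
    (hBA : ∀ k < n, mem k → ∀ u, B k u ≤ A k u)
    (hstart : ∀ k < n, mem k →
      (∀ s u, 0 ≤ s → s ≤ u → A k u - A k s ≤ c k + ρ * (u - s)) ∨
      (∃ j, k = j + 1 ∧ mem j ∧ A k = B j)) :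
    ∑ k ∈ Finset.range n, (if mem k then B k (t (k + 1)) - A k (t k) else 0) ≤
      ∑ k ∈ Finset.range n, (c k + if mem k then ρ * (t (k + 1) - t k) else 0) := by
  set S : ℕ → ℝ := fun m =>
    ∑ k ∈ Finset.range m, (if mem k then B k (t (k + 1)) - A k (t k) else 0) with hS
  set U : ℕ → ℝ := fun m =>
    ∑ k ∈ Finset.range m, (c k + if mem k then ρ * (t (k + 1) - t k) else 0) with hU
  have key : ∀ m, m ≤ n → 0 ≤ t m ∧ S m ≤ U m ∧ ∀ j, m = j + 1 → mem j → ∀ u, t m ≤ u →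
      S m - B j (t m) + B j u ≤ U m + ρ * (u - t m) := by
    intro m
    induction m with
    | zero => intro _; exact ⟨h0, by simp [hS, hU], by intro j hj; omega⟩
    | succ m ih =>
      intro hm
      obtain ⟨i0, i1, i2⟩ := ih (by omega)
      have hmm := hmono m (by omega)
      have eS : S (m + 1) = S m + (if mem m then B m (t (m + 1)) - A m (t m) else 0) := by
        simp only [hS, Finset.sum_range_succ]
      have eU : U (m + 1) = U m + (c m + if mem m then ρ * (t (m + 1) - t m) else 0) := by
        simp only [hU, Finset.sum_range_succ]
      have hcm := hc m
      have strong : mem m → ∀ u, t (m + 1) ≤ u →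
          S (m + 1) - B m (t (m + 1)) + B m u ≤ U (m + 1) + ρ * (u - t (m + 1)) := by
        intro hmem u hu
        rw [if_pos hmem] at eS eU
        have hb := hBA m (by omega) hmem u
        rcases hstart m (by omega) hmem with h | ⟨j, hj, hmj, hAB⟩
        · have := h (t m) u i0 (by linarith)
          rw [eS, eU]; linarith
        · have := i2 j hj hmj u (by linarith)
          rw [hAB] at hb eS
          rw [eS, eU]; linarith
      refine ⟨by linarith, ?_, ?_⟩
      · by_cases hmem : mem m
        · have := strong hmem _ le_rfl
          linarith
        · rw [if_neg hmem] at eS eU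
          rw [eS, eU]; linarith
      · intro j hj hmj
        obtain rfl : m = j := by omega
        exact strong hmj
  exact (key n le_rfl).2.1

theorem exists_times (P : ℕ → ℝ → ℝ → Prop) (n : ℕ)
    (h : ∀ k < n, ∀ u, 0 ≤ u → ∃ s, 0 ≤ s ∧ s ≤ u ∧ P k s u) :
    ∀ u, 0 ≤ u → ∃ t : ℕ → ℝ, t n = u ∧ 0 ≤ t 0 ∧
      ∀ k < n, t k ≤ t (k + 1) ∧ P k (t k) (t (k + 1)) := by
  induction n with
  | zero => intro u hu; exact ⟨fun _ => u, rfl, hu, by intro k hk; omega⟩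
  | succ n ih =>
    intro u hu
    obtain ⟨s, hs0, hsu, hP⟩ := h n (by omega) u hu
    obtain ⟨t, htn, ht0, ht⟩ := ih (fun k hk => h k (by omega)) s hs0
    refine ⟨fun k => if k ≤ n then t k else u, by simp, by simpa using ht0, ?_⟩
    intro k hk
    rcases Nat.lt_or_ge k n with hkn | hkn
    · have h1 : k ≤ n := by omega
      have h2 : k + 1 ≤ n := by omega
      simpa [h1, h2] using ht k hkn
    · obtain rfl : k = n := by omega
      simpa [htn] using And.intro hsu hP

theorem exists_start (A B : ℝ → ℝ) (hA : Continuous A) (hB : Continuous B)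
    (h0 : A 0 = B 0) (hle : ∀ u, B u ≤ A u) (u : ℝ) (hu : 0 ≤ u) :
    ∃ s, 0 ≤ s ∧ s ≤ u ∧ (A s = B s ∧ (s = u ∨ Backlogged A B s u)) := by
  have hcomp : IsCompact (Set.Icc 0 u ∩ {s | A s = B s}) :=
    isCompact_Icc.inter_right (isClosed_eq hA hB)
  obtain ⟨s, hs, hmax⟩ := hcomp.exists_isGreatest ⟨0, ⟨le_rfl, hu⟩, h0⟩
  refine ⟨s, hs.1.1, hs.1.2, hs.2, ?_⟩
  rcases eq_or_lt_of_le hs.1.2 with h | h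
  · exact Or.inl h
  · refine Or.inr ⟨h, fun v hv hvu => lt_of_le_of_ne (hle v) ?_⟩
    intro he
    have := hmax (show v ∈ _ from ⟨⟨by linarith [hs.1.1], hvu⟩, he.symm⟩)
    linarith

/-- Theorem 4 (end-to-end service curve in a unidirectional ring network with
cyclic dependencies under arbitrary multiplexing): the concatenation of the
nodes of `subpath_f(n)` offers flow `f` the rate-latency simple service curve
with rate `R = min_{k ∈ subpath_f(n)} (R^k - ∑_{j ≠ f : k ∈ path_j} ρ_j)` and latency
`T = ∑_k T^k + ∑_{i ∈ K_f(n)} (σ_i^{first_f ⊖ 1}·𝟙{i ∋ first_f, first_i ≠ first_f}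
+ σ_i^0·𝟙{first_i ∈ subpath_f(n)} + ρ_i ∑_{j ∈ subpath_f(n) ∩ path_i} T^j) / R`. -/
theorem ring_pmoo_service_curve
    {I : Type*} [Fintype I] [DecidableEq I]
    (M : ℕ) (hM : 1 ≤ M)
    (first len : I → ℕ)
    (hfirst : ∀ i, first i < M)
    (hlen : ∀ i, 1 ≤ len i ∧ len i ≤ M)
    -- path of flow i : the ring nodes first_i, first_i ⊕ 1, …, first_i ⊕ (h_i - 1)
    (path : I → Finset ℕ)
    (hpath : ∀ i, path i = (Finset.range (len i)).image (fun k => (first i + k) % M))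
    -- cumulative input/output functions of flow `i` at node `l`
    (F Fs : I → ℕ → ℝ → ℝ)
    (hFcum : ∀ i, ∀ l ∈ path i, Cumulative (F i l) ∧ Continuous (F i l))
    (hFscum : ∀ i, ∀ l ∈ path i, Cumulative (Fs i l) ∧ Continuous (Fs i l))
    (hle : ∀ i, ∀ l ∈ path i, ∀ t : ℝ, Fs i l t ≤ F i l t)
    (hlink : ∀ i, ∀ k : ℕ, k + 1 < len i →
      F i ((first i + k + 1) % M) = Fs i ((first i + k) % M))
    -- each node offers a strict rate-latency service curve to its aggregate
    (Rn Tn : ℕ → ℝ)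
    (hRn : ∀ l ∈ Finset.range M, 0 < Rn l)
    (hTn : ∀ l ∈ Finset.range M, 0 ≤ Tn l)
    (hstrict : ∀ l ∈ Finset.range M,
      OffersStrict
        (fun t => ∑ i ∈ Finset.univ.filter (fun i => l ∈ path i), F i l t)
        (fun t => ∑ i ∈ Finset.univ.filter (fun i => l ∈ path i), Fs i l t)
        (rateLatency (Rn l) (Tn l)))
    -- flow of interest and its subpath of length n
    (f : I) (n : ℕ) (hn1 : 1 ≤ n) (hn2 : n ≤ len f)
    (subpath : Finset ℕ)
    (hsubpath : subpath = (Finset.range n).image (fun k => (first f + k) % M))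
    -- the set of interfering flows
    (K : Finset I) (hK : ∀ i, i ∈ K ↔ i ≠ f ∧ (path i ∩ subpath).Nonempty)
    -- leaky-bucket constraints:
    -- σ0 i : initial burst of flow i at its source node first_i;
    -- σp i : burst of flow i at its input to node first_f (output of first_f ⊖ 1)
    (σ0 σp ρ : I → ℝ)
    (hσ0 : ∀ i ∈ K, 0 ≤ σ0 i) (hσp : ∀ i ∈ K, 0 ≤ σp i) (hρ : ∀ i ∈ K, 0 ≤ ρ i)
    (harr0 : ∀ i ∈ K, first i ∈ subpath →
      ArrivalCurve (leakyBucket (σ0 i) (ρ i)) (F i (first i)))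
    (harrp : ∀ i ∈ K, first f ∈ path i → first i ≠ first f →
      ArrivalCurve (leakyBucket (σp i) (ρ i)) (F i (first f)))
    -- the residual rate and the end-to-end latency
    (Rmin : ℝ)
    (hRmin : Rmin = sInf
      ((fun k => Rn k - ∑ j ∈ Finset.univ.filter (fun j => j ≠ f ∧ k ∈ path j), ρ j) ''
        (subpath : Set ℕ)))
    (hRpos : 0 < Rmin)
    (Ttot : ℝ)
    (hTtot : Ttot = (∑ k ∈ subpath, Tn k) +
      ∑ i ∈ K,
        ((if first f ∈ path i ∧ first i ≠ first f then σp i else 0) +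
         (if first i ∈ subpath then σ0 i else 0) +
         ρ i * ∑ j ∈ subpath ∩ path i, Tn j) / Rmin) :
    OffersSimple (F f (first f)) (Fs f ((first f + (n - 1)) % M))
      (rateLatency Rmin Ttot) := by
  have hMpos : 0 < M := hM
  set nd : ℕ → ℕ := fun k => (first f + k) % M with hnd
  have hnd0 : nd 0 = first f := by simp [hnd, Nat.mod_eq_of_lt (hfirst f)]
  have hndM : ∀ k, nd k ∈ Finset.range M := fun k => Finset.mem_range.2 (Nat.mod_lt _ hMpos)
  have hlenf := hlen f
  have hndf : ∀ k < n, nd k ∈ path f := by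
    intro k hk
    rw [hpath]
    exact Finset.mem_image.2 ⟨k, Finset.mem_range.2 (by omega), rfl⟩
  have hnds : ∀ k < n, nd k ∈ subpath := by
    intro k hk
    rw [hsubpath]
    exact Finset.mem_image.2 ⟨k, Finset.mem_range.2 hk, rfl⟩
  have hinj : Set.InjOn nd (Finset.range n : Set ℕ) := by
    intro a ha b hb hab
    simp only [Finset.coe_range, Set.mem_Iio] at ha hb
    have : a ≡ b [MOD M] := Nat.ModEq.add_left_cancel' (first f) hab
    exact Nat.ModEq.eq_of_lt_of_lt this (by omega) (by omega)
  have hsumsub : ∀ g : ℕ → ℝ, ∑ k ∈ subpath, g k = ∑ k ∈ Finset.range n, g (nd k) := by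
    intro g
    rw [hsubpath]
    exact Finset.sum_image hinj
  have hfirstmem : ∀ i, first i ∈ path i := by
    intro i
    rw [hpath]
    exact Finset.mem_image.2 ⟨0, Finset.mem_range.2 (hlen i).1,
      by simp [Nat.mod_eq_of_lt (hfirst i)]⟩
  have hprev : ∀ i k, nd (k + 1) ∈ path i → nd (k + 1) ≠ first i →
      nd k ∈ path i ∧ F i (nd (k + 1)) = Fs i (nd k) := by
    intro i k hk hne
    have hk' := hk
    rw [hpath] at hk'
    obtain ⟨j, hj, hje⟩ := Finset.mem_image.1 hk'
    rw [Finset.mem_range] at hj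
    rcases j with _ | j
    · exfalso; apply hne; rw [← hje]; simp [Nat.mod_eq_of_lt (hfirst i)]
    · have e : (first i + j) % M = nd k := by
        have : (first i + j) + 1 ≡ (first f + k) + 1 [MOD M] := hje
        exact Nat.ModEq.add_right_cancel' 1 this
      refine ⟨?_, ?_⟩
      · rw [hpath]
        exact Finset.mem_image.2 ⟨j, Finset.mem_range.2 (by omega), e⟩
      · rw [← hje, ← e]
        exact hlink i j hj
  have hfilt : ∀ k < n, ∀ g : I → ℝ,
      ∑ i ∈ Finset.univ.filter (fun i => i ≠ f ∧ nd k ∈ path i), g i =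
        ∑ i ∈ K, if nd k ∈ path i then g i else 0 := by
    intro k hk g
    rw [← Finset.sum_filter]
    apply Finset.sum_congr _ (fun _ _ => rfl)
    ext i
    simp only [Finset.mem_filter, Finset.mem_univ, true_and, hK]
    constructor
    · rintro ⟨h1, h2⟩
      exact ⟨⟨h1, nd k, Finset.mem_inter.2 ⟨h2, hnds k hk⟩⟩, h2⟩
    · rintro ⟨⟨h1, _⟩, h2⟩
      exact ⟨h1, h2⟩
  have hfilt2 : ∀ k < n, ∀ g : I → ℝ,
      ∑ i ∈ Finset.univ.filter (fun i => nd k ∈ path i), g i =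
        g f + ∑ i ∈ K, if nd k ∈ path i then g i else 0 := by
    intro k hk g
    rw [← hfilt k hk g, ← Finset.sum_insert (by simp)]
    apply Finset.sum_congr _ (fun _ _ => rfl)
    ext i
    simp only [Finset.mem_filter, Finset.mem_univ, true_and, Finset.mem_insert]
    by_cases hi : i = f
    · subst hi; simp [hndf k hk]
    · simp [hi]
  intro t ht
  -- backlogged period times
  obtain ⟨τ, hτn, hτ0, hτ⟩ := exists_times (fun k s u =>
      (∀ i, nd k ∈ path i → F i (nd k) s = Fs i (nd k) s) ∧
      Rn (nd k) * max (u - s - Tn (nd k)) 0 ≤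
        ∑ i ∈ Finset.univ.filter (fun i => nd k ∈ path i), (Fs i (nd k) u - F i (nd k) s)) n
    (by
      intro k hk u hu
      obtain ⟨s, hs0, hsu, heq, hb⟩ := exists_start
        (fun t => ∑ i ∈ Finset.univ.filter (fun i => nd k ∈ path i), F i (nd k) t)
        (fun t => ∑ i ∈ Finset.univ.filter (fun i => nd k ∈ path i), Fs i (nd k) t)
        (continuous_finsetSum _ fun i hi => (hFcum i _ (Finset.mem_filter.1 hi).2).2)
        (continuous_finsetSum _ fun i hi => (hFscum i _ (Finset.mem_filter.1 hi).2).2)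
        (Finset.sum_congr rfl fun i hi => by
          rw [(hFcum i _ (Finset.mem_filter.1 hi).2).1.2 0 le_rfl,
            (hFscum i _ (Finset.mem_filter.1 hi).2).1.2 0 le_rfl])
        (fun u => Finset.sum_le_sum fun i hi => hle i _ (Finset.mem_filter.1 hi).2 u) u hu
      have hind : ∀ i, nd k ∈ path i → F i (nd k) s = Fs i (nd k) s := by
        intro i hi
        have := (Finset.sum_eq_sum_iff_of_le
          (fun i hi => hle i _ (Finset.mem_filter.1 hi).2 s)).1 heq.symm
        exact (this i (by simp [hi])).symm
      refine ⟨s, hs0, hsu, hind, ?_⟩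
      rw [Finset.sum_sub_distrib]
      rw [heq]
      rcases hb with rfl | hb
      · have : max (s - s - Tn (nd k)) 0 = 0 := max_eq_right (by
          have := hTn _ (hndM k); linarith)
        rw [this]; simp
      · exact hstrict _ (hndM k) s u hb) t ht
  have hτmono : ∀ k < n, τ k ≤ τ (k + 1) := fun k hk => (hτ k hk).1
  -- telescoping for f
  have htel : ∀ m, m < n → ∑ k ∈ Finset.range (m + 1), (Fs f (nd k) (τ (k + 1)) - F f (nd k) (τ k)) =
      Fs f (nd m) (τ (m + 1)) - F f (first f) (τ 0) := by
    intro m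
    induction m with
    | zero => intro _; simp [hnd0]
    | succ m ih =>
      intro hm
      rw [Finset.sum_range_succ, ih (by omega)]
      have : F f (nd (m + 1)) = Fs f (nd m) := hlink f m (by omega)
      rw [this]; ring
  have htelf : ∑ k ∈ Finset.range n, (Fs f (nd k) (τ (k + 1)) - F f (nd k) (τ k)) =
      Fs f (nd (n - 1)) t - F f (first f) (τ 0) := by
    have := htel (n - 1) (by omega)
    rw [Nat.sub_add_cancel hn1, hτn] at this
    exact this
  have hnonneg : F f (first f) (τ 0) ≤ Fs f (nd (n - 1)) t := by
    have : 0 ≤ ∑ k ∈ Finset.range n, (Fs f (nd k) (τ (k + 1)) - F f (nd k) (τ k)) := by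
      apply Finset.sum_nonneg
      intro k hk
      rw [Finset.mem_range] at hk
      rw [(hτ k hk).2.1 f (hndf k hk)]
      have := (hFscum f _ (hndf k hk)).1.1 (hτmono k hk)
      linarith
    rw [htelf] at this
    linarith
  -- per-flow bound
  set c : I → ℕ → ℝ := fun i k =>
    (if k = 0 then (if first f ∈ path i ∧ first i ≠ first f then σp i else 0) else 0) +
      (if nd k = first i then (if first i ∈ subpath then σ0 i else 0) else 0) with hc
  have hflow : ∀ i ∈ K,
      ∑ k ∈ Finset.range n, (if nd k ∈ path i then Fs i (nd k) (τ (k + 1)) - F i (nd k) (τ k) else 0) ≤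
      ∑ k ∈ Finset.range n, (c i k + if nd k ∈ path i then ρ i * (τ (k + 1) - τ k) else 0) := by
    intro i hi
    have hp := hσp i hi
    have h0 := hσ0 i hi
    have hc1 : ∀ k, 0 ≤ (if k = 0 then (if first f ∈ path i ∧ first i ≠ first f then σp i else 0) else 0) := by
      intro k; split_ifs <;> simp [hp]
    have hc2 : ∀ k, 0 ≤ (if nd k = first i then (if first i ∈ subpath then σ0 i else 0) else 0) := by
      intro k; split_ifs <;> simp [h0]
    refine seg_bound n (fun k => nd k ∈ path i) (fun k => F i (nd k)) (fun k => Fs i (nd k)) τ (c i)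
      (ρ i) hτ0 hτmono (fun k => add_nonneg (hc1 k) (hc2 k)) (fun k _ hm u => hle i _ hm u) ?_
    intro k hk hm
    by_cases hfk : nd k = first i
    · left
      intro s u hs hsu
      have hsub : first i ∈ subpath := hfk ▸ hnds k hk
      have h1 := harr0 i hi hsub s u hs hsu
      have h2 := hc1 k
      simp only [leakyBucket] at h1
      simp only [hc, if_pos hfk, if_pos hsub]
      rw [hfk]
      linarith
    · rcases k with _ | k
      · left
        intro s u hs hsu
        simp only [hnd0] at hm hfk ⊢
        have h1 := harrp i hi hm (Ne.symm hfk) s u hs hsu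
        have h2 := hc2 0
        simp only [leakyBucket] at h1
        simp only [hc, if_true, if_pos (And.intro hm (Ne.symm hfk))]
        linarith
      · right
        exact ⟨k, rfl, hprev i k hm hfk⟩
  have hcsum : ∀ i, ∑ k ∈ Finset.range n, c i k =
      (if first f ∈ path i ∧ first i ≠ first f then σp i else 0) +
         (if first i ∈ subpath then σ0 i else 0) := by
    intro i
    simp only [hc]
    rw [Finset.sum_add_distrib,
      ← hsumsub (fun l => if l = first i then (if first i ∈ subpath then σ0 i else 0) else 0),
      Finset.sum_ite_eq', Finset.sum_ite_eq']
    congr 1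
    · rw [if_pos (Finset.mem_range.2 hn1)]
    · split_ifs <;> rfl
  have hTsum : ∀ i, ∑ j ∈ subpath ∩ path i, Tn j =
      ∑ k ∈ Finset.range n, if nd k ∈ path i then Tn (nd k) else 0 := by
    intro i
    rw [← hsumsub (fun l => if l ∈ path i then Tn l else 0), ← Finset.sum_filter,
      Finset.filter_mem_eq_inter]
  set r : ℕ → ℝ := fun k => ∑ i ∈ K, if nd k ∈ path i then ρ i else 0 with hr
  have hrnn : ∀ k, 0 ≤ r k := fun k => Finset.sum_nonneg fun i hi => by
    have := hρ i hi
    split_ifs <;> simp [this]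
  have hRk : ∀ k < n, Rmin ≤ Rn (nd k) - r k := by
    intro k hk
    rw [hRmin, hr]
    simp only
    rw [← hfilt k hk]
    apply csInf_le
    · exact (Set.Finite.image _ (Finset.finite_toSet subpath)).bddBelow
    · exact ⟨nd k, hnds k hk, rfl⟩
  -- per-node bound
  have hnode : ∀ k < n, Rmin * (τ (k + 1) - τ k) - Rmin * Tn (nd k) - r k * Tn (nd k)
        + r k * (τ (k + 1) - τ k) ≤
      (Fs f (nd k) (τ (k + 1)) - F f (nd k) (τ k)) +
      ∑ i ∈ K, if nd k ∈ path i then Fs i (nd k) (τ (k + 1)) - F i (nd k) (τ k) else 0 := by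
    intro k hk
    have h1 := (hτ k hk).2.2
    rw [hfilt2 k hk] at h1
    refine le_trans ?_ h1
    set y := max (τ (k + 1) - τ k - Tn (nd k)) 0 with hy
    have hy0 : 0 ≤ y := le_max_right _ _
    have hy1 : τ (k + 1) - τ k - Tn (nd k) ≤ y := le_max_left _ _
    have a1 := mul_le_mul_of_nonneg_left hy1 (hrnn k)
    have a2 := mul_le_mul_of_nonneg_right (hRk k hk) hy0
    have a3 := mul_le_mul_of_nonneg_left hy1 hRpos.le
    nlinarith
  have hsumnode := Finset.sum_le_sum (fun k hk => hnode k (Finset.mem_range.1 hk))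
  rw [Finset.sum_add_distrib, Finset.sum_add_distrib, Finset.sum_sub_distrib,
    Finset.sum_sub_distrib, htelf, ← Finset.mul_sum, ← Finset.mul_sum, Finset.sum_range_sub, hτn,
    Finset.sum_comm (s := Finset.range n) (t := K)] at hsumnode
  have hsumflow := Finset.sum_le_sum hflow
  simp only [Finset.sum_add_distrib, hcsum] at hsumflow
  have hex : ∀ g : ℕ → ℝ, ∑ i ∈ K, ∑ k ∈ Finset.range n, (if nd k ∈ path i then ρ i * g k else 0) =
      ∑ k ∈ Finset.range n, r k * g k := by
    intro g
    rw [Finset.sum_comm]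
    refine Finset.sum_congr rfl fun k _ => ?_
    rw [hr, Finset.sum_mul]
    exact Finset.sum_congr rfl fun i _ => by split_ifs <;> simp
  rw [hex (fun k => τ (k + 1) - τ k)] at hsumflow
  have hTR : Rmin * Ttot = Rmin * (∑ k ∈ Finset.range n, Tn (nd k)) +
      ((∑ i ∈ K, (if first f ∈ path i ∧ first i ≠ first f then σp i else 0) +
        ∑ i ∈ K, (if first i ∈ subpath then σ0 i else 0)) +
        ∑ k ∈ Finset.range n, r k * Tn (nd k)) := by
    rw [hTtot, ← Finset.sum_div, mul_add, mul_div_cancel₀ _ hRpos.ne', hsumsub, ← hex,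
      Finset.sum_add_distrib, Finset.sum_add_distrib]
    congr 2
    refine Finset.sum_congr rfl fun i _ => ?_
    rw [hTsum, Finset.mul_sum]
    exact Finset.sum_congr rfl fun k _ => by split_ifs <;> simp
  have hmain : F f (first f) (τ 0) + Rmin * (t - τ 0 - Ttot) ≤ Fs f (nd (n - 1)) t := by
    have : Rmin * (t - τ 0 - Ttot) = Rmin * (t - τ 0) - Rmin * Ttot := by ring
    rw [this, hTR]
    linarith
  have hτt : ∀ m ≤ n, τ 0 ≤ τ m := by
    intro m
    induction m with
    | zero => intro _; exact le_rfl
    | succ m ih => intro hm; exact (ih (by omega)).trans (hτmono m (by omega))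
  refine csInf_le_of_le (b := F f (first f) (τ 0) + rateLatency Rmin Ttot (t - τ 0))
    ⟨0, ?_⟩ ⟨τ 0, ⟨hτ0, hτn ▸ hτt n le_rfl⟩, rfl⟩ ?_
  · rintro _ ⟨s, hs, rfl⟩
    have h1 := (hFcum f _ (hfirstmem f)).1
    have h2 := h1.1 hs.1
    rw [h1.2 0 le_rfl] at h2
    exact add_nonneg h2 (mul_nonneg hRpos.le (le_max_right _ _))
  · simp only [rateLatency]
    rcases le_total (t - τ 0 - Ttot) 0 with h | h
    · rw [max_eq_right h]; simpa using hnonneg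
    · rw [max_eq_left h]; exact hmain
end

section
/- Consider a unidirectional ring of M nodes labelled 0,…,M−1 (with ⊕, ⊖ denoting addition and subtraction modulo M) and a finite set I of flows traversing consecutive ring paths path_i = (first_i, …, first_i⊕(h_i−1)), where each flow i has a fixed priority P(i) ∈ ℕ (0 being the highest) and a maximum packet length L_max(i) > 0. Fix a flow of interest f; for each node k let hp_f^k = {i ≠ f : k ∈ path_i, P(i) ≤ P(f)} and lp_f^k = {i : k ∈ path_i, P(i) > P(f)}. For each flow i with P(i) ≤ P(f) and each node l ∈ path_i, let F_i^l and F_i^{l,*} be continuous cumulative input and output functions with F_i^{l,*} ≤ F_i^l pointwise and F_i^{l⊕1} = F_i^{l,*} along path_i. Assume that under non-preemptive fixed-priority multiplexing each node k offers to the aggregate of the flows {i : k ∈ path_i, P(i) ≤ P(f)} a strict service curve of rate-latency type with rate R^k > 0 and latency T^k + max_{j ∈ lp_f^k} L_max(j)/R^k (the maximum being 0 if lp_f^k is empty), where T^k ≥ 0. Fix n with 1 ≤ n ≤ h_f, let subpath_f(n) = (first_f, …, first_f⊕(n−1)), and let K_{≤f}(n) be the set of flows i ≠ f with P(i) ≤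 P(f) and path_i ∩ subpath_f(n) ≠ ∅. Assume: (a) every i ∈ K_{≤f}(n) whose source first_i lies on subpath_f(n) is (σ_i^0, ρ_i)-leaky-bucket constrained at its input to node first_i; (b) every i ∈ K_{≤f}(n) that crosses node first_f with first_i ≠ first_f is (σ_i^{first_f⊖1}, ρ_i)-leaky-bucket constrained at its input to node first_f; all bursts are ≥ 0 and all rates ρ_i ≥ 0. Assume R := min_{k ∈ subpath_f(n)} (R^k − ∑_{j ∈ hp_f^k} ρ_j) > 0. Then the concatenation of the nodes of subpath_f(n) offers to flow f the simple service curve β_{R,T}, where T = ∑_{k ∈ subpath_f(n)} (T^k + max_{j ∈ lp_f^k} L_max(j)/R^k) + ∑_{i ∈ K_{≤f}(n)} ( σ_i^{first_f⊖1}·𝟙{i crosses first_f and first_i ≠ first_f} + σ_i^0·𝟙{first_i ∈ subpath_f(n)} + ρ_i · ∑_{j ∈ subpath_f(n) ∩ path_i} (T^j + max_{p ∈ lp_f^j} L_max(p)/R^j) ) / R. -/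
lemma ring_aux_start (A As : ℝ → ℝ) (hA : Continuous A) (hAs : Continuous As)
    (h0 : A 0 = As 0) (hle : ∀ u, As u ≤ A u) (T : ℝ) (hT : 0 ≤ T) :
    ∃ s, 0 ≤ s ∧ s ≤ T ∧ A s = As s ∧ ∀ u, s < u → u ≤ T → As u < A u := by
  have hc : IsCompact (Set.Icc (0:ℝ) T ∩ {u | A u = As u}) :=
    isCompact_Icc.inter_right (isClosed_eq hA hAs)
  obtain ⟨s, hs, hmax⟩ := hc.exists_isGreatest ⟨0, ⟨le_refl 0, hT⟩, h0⟩
  refine ⟨s, hs.1.1, hs.1.2, hs.2, fun u hu huT => lt_of_le_of_ne (hle u) fun h => ?_⟩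
  have : u ≤ s := hmax ⟨⟨hs.1.1.trans hu.le, huT⟩, h.symm⟩
  linarith

lemma ring_aux_times (A As : ℕ → ℝ → ℝ) (n : ℕ)
    (hA : ∀ k < n, Continuous (A k)) (hAs : ∀ k < n, Continuous (As k))
    (h0 : ∀ k < n, A k 0 = As k 0) (hle : ∀ k < n, ∀ u, As k u ≤ A k u) :
    ∀ T : ℝ, 0 ≤ T → ∃ t : ℕ → ℝ, t n = T ∧ 0 ≤ t 0 ∧ ∀ k < n, 0 ≤ t k ∧ t k ≤ t (k+1) ∧
      A k (t k) = As k (t k) ∧ ∀ u, t k < u → u ≤ t (k+1) → As k u < A k u := by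
  induction n with
  | zero => intro T hT; exact ⟨fun _ => T, rfl, hT, by simp⟩
  | succ n ih =>
    intro T hT
    obtain ⟨s, hs0, hsT, hs1, hs2⟩ := ring_aux_start (A n) (As n) (hA n (by simp)) (hAs n (by simp))
      (h0 n (by simp)) (hle n (by simp)) T hT
    obtain ⟨t, ht, ht0, htk⟩ := ih (fun k hk => hA k (by omega)) (fun k hk => hAs k (by omega))
      (fun k hk => h0 k (by omega)) (fun k hk => hle k (by omega)) s hs0
    refine ⟨fun k => if k = n + 1 then T else t k, by simp, by simpa using ht0, fun k hk => ?_⟩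
    rcases Nat.lt_succ_iff_lt_or_eq.mp hk with h | rfl
    · have h1 : k ≠ n + 1 := by omega
      have h2 : k + 1 ≠ n + 1 := by omega
      simp only [h1, h2, if_false]
      exact htk k h
    · simp only [if_true, ht, show k ≠ k + 1 by omega, if_false]
      exact ⟨hs0, hsT, hs1, hs2⟩

lemma ring_aux_seg (G Gs : ℕ → ℝ → ℝ) (p : ℕ → Prop) [DecidablePred p] (σ : ℕ → ℝ) (ρ : ℝ)
    (t : ℕ → ℝ) (n : ℕ) (hσ : ∀ k < n, 0 ≤ σ k)
    (ht : ∀ k < n, t k ≤ t (k+1))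
    (hle : ∀ k < n, p k → ∀ u, Gs k u ≤ G k u)
    (hstep : ∀ k < n, p k → (∃ j, k = j + 1 ∧ p j ∧ G k = Gs j) ∨
      (∀ u, t k ≤ u → G k u - G k (t k) ≤ σ k + ρ * (u - t k))) :
    ∑ k ∈ Finset.range n, (if p k then Gs k (t (k+1)) - G k (t k) - ρ * (t (k+1) - t k) else 0)
      ≤ ∑ k ∈ Finset.range n, σ k := by
  have key : ∀ m, m ≤ n →
      (∑ k ∈ Finset.range m, (if p k then Gs k (t (k+1)) - G k (t k) - ρ * (t (k+1) - t k) else 0)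
        ≤ ∑ k ∈ Finset.range m, σ k) ∧
      ∀ j, m = j + 1 → p j → ∀ u, t m ≤ u →
       ∑ k ∈ Finset.range m, (if p k then Gs k (t (k+1)) - G k (t k) - ρ * (t (k+1) - t k) else 0)
        + Gs j u - Gs j (t m) - ρ * (u - t m) ≤ ∑ k ∈ Finset.range m, σ k := by
    intro m
    induction m with
    | zero => intro _; simp
    | succ m ih =>
      intro hm
      obtain ⟨ih1, ih2⟩ := ih (by omega)
      have hs := hσ m (by omega)
      have htm := ht m (by omega)
      rw [Finset.sum_range_succ, Finset.sum_range_succ]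
      by_cases hp : p m
      · simp only [hp, if_true]
        have main : ∀ u, t (m+1) ≤ u → ∑ k ∈ Finset.range m,
          (if p k then Gs k (t (k+1)) - G k (t k) - ρ * (t (k+1) - t k) else 0)
            + (Gs m (t (m+1)) - G m (t m) - ρ * (t (m+1) - t m))
            + Gs m u - Gs m (t (m+1)) - ρ * (u - t (m+1)) ≤ ∑ k ∈ Finset.range m, σ k + σ m := by
          intro u hu
          have h1 := hle m (by omega) hp u
          rcases hstep m (by omega) hp with ⟨j, hj, hpj, hG⟩ | h
          · have := ih2 j hj hpj u (htm.trans hu)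
            rw [← hG] at this
            linarith
          · have := h u (htm.trans hu)
            linarith
        refine ⟨?_, ?_⟩
        · have := main _ le_rfl
          linarith
        · intro j hj _ u hu
          obtain rfl : m = j := by omega
          exact main u hu
      · simp only [hp, if_false]
        refine ⟨by linarith, ?_⟩
        intro j hj hpj
        obtain rfl : m = j := by omega
        exact absurd hpj hp
  exact (key n le_rfl).1

lemma ring_aux_tele (G Gs : ℕ → ℝ → ℝ) (t : ℕ → ℝ) (m : ℕ)
    (h : ∀ k < m, G (k+1) = Gs k) :
    ∑ k ∈ Finset.range (m+1), (Gs k (t (k+1)) - G k (t k)) = Gs m (t (m+1)) - G 0 (t 0) := by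
  induction m with
  | zero => simp
  | succ m ih =>
    rw [Finset.sum_range_succ, ih (fun k hk => h k (by omega)), h m (by omega)]
    ring


/-- Corollary 2 (end-to-end service curve in a ring network under non-preemptive
fixed-priority multiplexing): the concatenation of the nodes of `subpath_f(n)`
offers flow `f` the rate-latency simple service curve with rate
`R = min_{k ∈ subpath_f(n)} (R^k - ∑_{j ∈ hp_f^k} ρ_j)` and latency
`T = ∑_k (T^k + max_{j ∈ lp_f^k} L_max(j)/R^k)
+ ∑_{i ∈ K_{≤f}(n)} (σ_i^{first_f ⊖ 1}·𝟙{i ∋ first_f, first_i ≠ first_f}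
+ σ_i^0·𝟙{first_i ∈ subpath_f(n)}
+ ρ_i ∑_{j ∈ subpath_f(n) ∩ path_i} (T^j + max_{p ∈ lp_f^j} L_max(p)/R^j)) / R`. -/
theorem ring_pmoo_service_curve_fixed_priority
    {I : Type*} [Fintype I] [DecidableEq I]
    (M : ℕ) (hM : 1 ≤ M)
    (first len : I → ℕ)
    (hfirst : ∀ i, first i < M)
    (hlen : ∀ i, 1 ≤ len i ∧ len i ≤ M)
    -- path of flow i : the ring nodes first_i, first_i ⊕ 1, …, first_i ⊕ (h_i - 1)
    (path : I → Finset ℕ)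
    (hpath : ∀ i, path i = (Finset.range (len i)).image (fun k => (first i + k) % M))
    -- fixed priorities (0 highest) and maximum packet lengths
    (P : I → ℕ) (Lmax : I → ℝ) (hLmax : ∀ i, 0 < Lmax i)
    -- flow of interest
    (f : I)
    -- maximum packet length of the lower-priority flows crossing node k (0 if none)
    (lpMax : ℕ → ℝ)
    (hlpMax : ∀ k : ℕ, lpMax k = sSup (Lmax '' {j : I | k ∈ path j ∧ P f < P j}))
    -- cumulative input/output functions of each flow of priority ≤ P f at each node
    (F Fs : I → ℕ → ℝ → ℝ)
    (hFcum : ∀ i, P i ≤ P f → ∀ l ∈ path i, Cumulative (F i l) ∧ Continuous (F i l))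
    (hFscum : ∀ i, P i ≤ P f → ∀ l ∈ path i, Cumulative (Fs i l) ∧ Continuous (Fs i l))
    (hle : ∀ i, P i ≤ P f → ∀ l ∈ path i, ∀ t : ℝ, Fs i l t ≤ F i l t)
    (hlink : ∀ i, P i ≤ P f → ∀ k : ℕ, k + 1 < len i →
      F i ((first i + k + 1) % M) = Fs i ((first i + k) % M))
    -- under NP-FP multiplexing, each node offers the aggregate of the flows of
    -- priority ≤ P f crossing it a strict rate-latency service curve with rate R^k
    -- and latency T^k + max_{j ∈ lp_f^k} L_max(j)/R^k
    (Rn Tn : ℕ → ℝ)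
    (hRn : ∀ l ∈ Finset.range M, 0 < Rn l)
    (hTn : ∀ l ∈ Finset.range M, 0 ≤ Tn l)
    (hstrict : ∀ l ∈ Finset.range M,
      OffersStrict
        (fun t => ∑ i ∈ Finset.univ.filter (fun i => l ∈ path i ∧ P i ≤ P f), F i l t)
        (fun t => ∑ i ∈ Finset.univ.filter (fun i => l ∈ path i ∧ P i ≤ P f), Fs i l t)
        (rateLatency (Rn l) (Tn l + lpMax l / Rn l)))
    -- subpath of length n of the flow of interest
    (n : ℕ) (hn1 : 1 ≤ n) (hn2 : n ≤ len f)
    (subpath : Finset ℕ)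
    (hsubpath : subpath = (Finset.range n).image (fun k => (first f + k) % M))
    -- the set of interfering flows of priority higher than or equal to that of f
    (K : Finset I)
    (hK : ∀ i, i ∈ K ↔ i ≠ f ∧ P i ≤ P f ∧ (path i ∩ subpath).Nonempty)
    -- leaky-bucket constraints:
    -- σ0 i : initial burst of flow i at its source node first_i;
    -- σp i : burst of flow i at its input to node first_f (output of first_f ⊖ 1)
    (σ0 σp ρ : I → ℝ)
    (hσ0 : ∀ i ∈ K, 0 ≤ σ0 i) (hσp : ∀ i ∈ K, 0 ≤ σp i) (hρ : ∀ i ∈ K, 0 ≤ ρ i)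
    (harr0 : ∀ i ∈ K, first i ∈ subpath →
      ArrivalCurve (leakyBucket (σ0 i) (ρ i)) (F i (first i)))
    (harrp : ∀ i ∈ K, first f ∈ path i → first i ≠ first f →
      ArrivalCurve (leakyBucket (σp i) (ρ i)) (F i (first f)))
    -- the residual rate and the end-to-end latency
    (Rmin : ℝ)
    (hRmin : Rmin = sInf
      ((fun k => Rn k -
          ∑ j ∈ Finset.univ.filter (fun j => j ≠ f ∧ k ∈ path j ∧ P j ≤ P f), ρ j) ''
        (subpath : Set ℕ)))
    (hRpos : 0 < Rmin)
    (Ttot : ℝ)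
    (hTtot : Ttot = (∑ k ∈ subpath, (Tn k + lpMax k / Rn k)) +
      ∑ i ∈ K,
        ((if first f ∈ path i ∧ first i ≠ first f then σp i else 0) +
         (if first i ∈ subpath then σ0 i else 0) +
         ρ i * ∑ j ∈ subpath ∩ path i, (Tn j + lpMax j / Rn j)) / Rmin) :
    OffersSimple (F f (first f)) (Fs f ((first f + (n - 1)) % M))
      (rateLatency Rmin Ttot) := by
  have hMpos : 0 < M := hM
  set N : ℕ → ℕ := fun k => (first f + k) % M with hN
  have hN0 : N 0 = first f := by simp [hN, Nat.mod_eq_of_lt (hfirst f)]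
  have hNM : ∀ k, N k ∈ Finset.range M := fun k => Finset.mem_range.2 (Nat.mod_lt _ hMpos)
  have hnM : n ≤ M := hn2.trans (hlen f).2
  have hinj : Set.InjOn N (Finset.range n : Set ℕ) := by
    intro a ha b hb hab
    simp only [Finset.coe_range, Set.mem_Iio] at ha hb
    have h1 : a ≡ b [MOD M] := Nat.ModEq.add_left_cancel' (first f) hab
    exact Nat.ModEq.eq_of_lt_of_lt h1 (by omega) (by omega)
  have hsum : ∀ g : ℕ → ℝ, ∑ v ∈ subpath, g v = ∑ k ∈ Finset.range n, g (N k) := by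
    intro g
    rw [hsubpath, Finset.sum_image hinj]
  have hNsub : ∀ k < n, N k ∈ subpath := fun k hk => by
    rw [hsubpath]; exact Finset.mem_image_of_mem _ (Finset.mem_range.2 hk)
  have hNf : ∀ k < n, N k ∈ path f := fun k hk => by
    rw [hpath]; exact Finset.mem_image_of_mem _ (Finset.mem_range.2 (by omega))
  set L : ℕ → ℝ := fun k => Tn k + lpMax k / Rn k with hL
  have hL0 : ∀ k ∈ Finset.range M, 0 ≤ L k := by
    intro k hk
    have h1 : 0 ≤ lpMax k := by
      rw [hlpMax]
      apply Real.sSup_nonneg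
      rintro _ ⟨j, _, rfl⟩
      exact (hLmax j).le
    have h2 := hTn k hk
    have h3 := div_nonneg h1 (hRn k hk).le
    simp only [hL]; linarith
  -- sums over flows crossing node N k
  have hsplit : ∀ k < n, ∀ x : I → ℝ,
      ∑ i ∈ Finset.univ.filter (fun j => j ≠ f ∧ N k ∈ path j ∧ P j ≤ P f), x i
        = ∑ i ∈ K, if N k ∈ path i then x i else 0 := by
    intro k hk x
    rw [← Finset.sum_filter]
    apply Finset.sum_congr _ (fun _ _ => rfl)
    ext i
    simp only [Finset.mem_filter, Finset.mem_univ, true_and, hK]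
    constructor
    · rintro ⟨h1, h2, h3⟩
      exact ⟨⟨h1, h3, N k, Finset.mem_inter.2 ⟨h2, hNsub k hk⟩⟩, h2⟩
    · rintro ⟨⟨h1, h3, _⟩, h2⟩
      exact ⟨h1, h2, h3⟩
  have hsplit2 : ∀ k < n, ∀ x : I → ℝ,
      ∑ i ∈ Finset.univ.filter (fun i => N k ∈ path i ∧ P i ≤ P f), x i
        = x f + ∑ i ∈ K, if N k ∈ path i then x i else 0 := by
    intro k hk x
    rw [← hsplit k hk, ← Finset.add_sum_erase _ x
      (show f ∈ Finset.univ.filter (fun i => N k ∈ path i ∧ P i ≤ P f) by simp [hNf k hk])]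
    congr 1
    apply Finset.sum_congr _ (fun _ _ => rfl)
    ext i
    simp
  have hRk : ∀ k < n, Rmin ≤ Rn (N k) - ∑ i ∈ K, if N k ∈ path i then ρ i else 0 := by
    intro k hk
    rw [hRmin, ← hsplit k hk ρ]
    apply csInf_le
    · exact ((Finset.finite_toSet subpath).image _).bddBelow
    · exact ⟨N k, hNsub k hk, rfl⟩
  intro t0 ht0
  -- times
  obtain ⟨t, htn, ht00, htk⟩ := ring_aux_times
    (fun k u => ∑ i ∈ Finset.univ.filter (fun i => N k ∈ path i ∧ P i ≤ P f), F i (N k) u)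
    (fun k u => ∑ i ∈ Finset.univ.filter (fun i => N k ∈ path i ∧ P i ≤ P f), Fs i (N k) u) n
    (fun k hk => continuous_finsetSum _ fun i hi => by
      simp only [Finset.mem_filter] at hi
      exact (hFcum i hi.2.2 _ hi.2.1).2)
    (fun k hk => continuous_finsetSum _ fun i hi => by
      simp only [Finset.mem_filter] at hi
      exact (hFscum i hi.2.2 _ hi.2.1).2)
    (fun k hk => Finset.sum_congr rfl fun i hi => by
      simp only [Finset.mem_filter] at hi
      rw [(hFcum i hi.2.2 _ hi.2.1).1.2 0 le_rfl, (hFscum i hi.2.2 _ hi.2.1).1.2 0 le_rfl])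
    (fun k hk u => Finset.sum_le_sum fun i hi => by
      simp only [Finset.mem_filter] at hi
      exact hle i hi.2.2 _ hi.2.1 u) t0 ht0
  -- pointwise equality at t k
  have heq : ∀ k < n, ∀ i, N k ∈ path i → P i ≤ P f → F i (N k) (t k) = Fs i (N k) (t k) := by
    intro k hk i hi hPi
    have h := (htk k hk).2.2.1
    have h2 := (Finset.sum_eq_sum_iff_of_le (s := Finset.univ.filter
      (fun i => N k ∈ path i ∧ P i ≤ P f)) (f := fun i => Fs i (N k) (t k))
      (g := fun i => F i (N k) (t k)) (fun i hi => by
        simp only [Finset.mem_filter] at hi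
        exact hle i hi.2.2 _ hi.2.1 _)).1 h.symm
    exact (h2 i (by simp [hi, hPi])).symm
  -- service at each node
  have hserv : ∀ k < n, Rn (N k) * max (t (k+1) - t k - L (N k)) 0 ≤
      (Fs f (N k) (t (k+1)) - F f (N k) (t k)) +
      ∑ i ∈ K, if N k ∈ path i then Fs i (N k) (t (k+1)) - F i (N k) (t k) else 0 := by
    intro k hk
    rw [← hsplit2 k hk (fun i => Fs i (N k) (t (k+1)) - F i (N k) (t k)), Finset.sum_sub_distrib]
    obtain ⟨h0, h1, h2, h3⟩ := htk k hk
    rw [h2]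
    rcases h1.lt_or_eq with h | h
    · exact hstrict (N k) (hNM k) (t k) (t (k+1)) ⟨h, h3⟩
    · rw [← h]
      have := hL0 (N k) (hNM k)
      rw [max_eq_right (by linarith)]
      simp
  -- telescoping of f
  obtain ⟨m, rfl⟩ : ∃ m, n = m + 1 := ⟨n - 1, by omega⟩
  have htele := ring_aux_tele (fun k => F f (N k)) (fun k => Fs f (N k)) t m (by
    intro k hk
    have := hlink f le_rfl k (by omega)
    simpa [hN, add_assoc] using this)
  simp only [hN0, htn] at htele
  -- interfering flows
  have hflow : ∀ i ∈ K, ∑ k ∈ Finset.range (m+1), (if N k ∈ path i then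
      Fs i (N k) (t (k+1)) - F i (N k) (t k) - ρ i * (t (k+1) - t k) else 0) ≤
      (if first f ∈ path i ∧ first i ≠ first f then σp i else 0) +
         (if first i ∈ subpath then σ0 i else 0) := by
    intro i hi
    obtain ⟨hif, hPi, hne⟩ := (hK i).1 hi
    have h0 := hσ0 i hi
    have hp := hσp i hi
    let g : ℕ → ℝ := fun v =>
      (if v = first f then (if first f ∈ path i ∧ first i ≠ first f then σp i else 0) else 0) +
      (if v = first i then σ0 i else 0)
    have hg1 : ∀ v, 0 ≤ (if v = first f then
      (if first f ∈ path i ∧ first i ≠ first f then σp i else 0) else 0) := by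
      intro v; split_ifs <;> simp [hp]
    have hg2 : ∀ v, 0 ≤ (if v = first i then σ0 i else 0) := by
      intro v; split_ifs <;> simp [h0]
    have hfs : first f ∈ subpath := hN0 ▸ hNsub 0 (by omega)
    have hgsum : ∑ k ∈ Finset.range (m+1), g (N k) =
      (if first f ∈ path i ∧ first i ≠ first f then σp i else 0) +
         (if first i ∈ subpath then σ0 i else 0) := by
      rw [← hsum g]
      simp only [g, Finset.sum_add_distrib, Finset.sum_ite_eq', hfs, if_true]
    rw [← hgsum]
    apply ring_aux_seg (fun k => F i (N k)) (fun k => Fs i (N k)) (fun k => N k ∈ path i)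
      (fun k => g (N k)) (ρ i) t (m+1)
    · intro k hk; exact add_nonneg (hg1 _) (hg2 _)
    · intro k hk; exact (htk k hk).2.1
    · intro k hk hpk u; exact hle i hPi _ hpk u
    · intro k hk hpk
      by_cases hfi : N k = first i
      · right
        intro u hu
        have hsub : first i ∈ subpath := hfi ▸ hNsub k hk
        have h1 := harr0 i hi hsub (t k) u (htk k hk).1 hu
        have h2 := hg1 (N k)
        simp only [g, leakyBucket, hfi, if_true] at h1 h2 ⊢
        linarith
      · rcases Nat.eq_zero_or_pos k with rfl | hkpos
        · right
          intro u hu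
          rw [hN0] at hfi hpk
          have h1 := harrp i hi hpk (Ne.symm hfi) (t 0) u ht00 hu
          simp only [g, leakyBucket, hN0, if_true, hfi, if_false, hpk, Ne.symm hfi, ne_eq,
            not_false_eq_true, and_self] at h1 ⊢
          linarith
        · left
          obtain ⟨j, rfl⟩ : ∃ j, k = j + 1 := ⟨k - 1, by omega⟩
          have hpk' := hpk
          simp only [hpath i, Finset.mem_image, Finset.mem_range] at hpk'
          obtain ⟨a, ha, hae⟩ := hpk'
          rcases Nat.eq_zero_or_pos a with rfl | hapos
          · exfalso
            apply hfi
            rw [← hae, add_zero, Nat.mod_eq_of_lt (hfirst i)]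
          · obtain ⟨b, rfl⟩ : ∃ b, a = b + 1 := ⟨a - 1, by omega⟩
            have hb : (first i + b) % M = N j := by
              have : first i + b + 1 ≡ first f + j + 1 [MOD M] := hae
              exact Nat.ModEq.add_right_cancel' 1 this
            refine ⟨j, rfl, ?_, ?_⟩
            · rw [← hb, hpath i]
              exact Finset.mem_image_of_mem _ (Finset.mem_range.2 (by omega))
            · have h1 := hlink i hPi b ha
              rw [hb] at h1
              rw [← h1, ← hae, add_assoc]
  -- nodewise lower bound
  have hnode : ∀ k < m + 1, Rmin * (t (k+1) - t k - L (N k))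
      - ∑ i ∈ K, (if N k ∈ path i then ρ i * L (N k) else 0) ≤
      (Fs f (N k) (t (k+1)) - F f (N k) (t k)) +
      ∑ i ∈ K, (if N k ∈ path i then
        Fs i (N k) (t (k+1)) - F i (N k) (t k) - ρ i * (t (k+1) - t k) else 0) := by
    intro k hk
    have h1 := hserv k hk
    have h2 := hRk k hk
    have hr0 : 0 ≤ ∑ i ∈ K, if N k ∈ path i then ρ i else 0 :=
      Finset.sum_nonneg fun i hi => by split_ifs <;> simp [hρ i hi]
    have e1 : ∑ i ∈ K, (if N k ∈ path i then ρ i * L (N k) else 0) =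
        (∑ i ∈ K, if N k ∈ path i then ρ i else 0) * L (N k) := by
      rw [Finset.sum_mul]; exact Finset.sum_congr rfl fun i _ => by split_ifs <;> simp
    have e2 : ∑ i ∈ K, (if N k ∈ path i then
        Fs i (N k) (t (k+1)) - F i (N k) (t k) - ρ i * (t (k+1) - t k) else 0) =
        (∑ i ∈ K, if N k ∈ path i then Fs i (N k) (t (k+1)) - F i (N k) (t k) else 0) -
        (∑ i ∈ K, if N k ∈ path i then ρ i else 0) * (t (k+1) - t k) := by
      rw [Finset.sum_mul, ← Finset.sum_sub_distrib]
      exact Finset.sum_congr rfl fun i _ => by split_ifs <;> simp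
    rw [e1, e2]
    generalize (∑ i ∈ K, if N k ∈ path i then ρ i else 0) = r at *
    have m1 := le_max_left (t (k+1) - t k - L (N k)) 0
    have m2 := le_max_right (t (k+1) - t k - L (N k)) 0
    generalize max (t (k+1) - t k - L (N k)) 0 = y at *
    have a1 : Rmin * (t (k+1) - t k - L (N k)) ≤ Rmin * y := mul_le_mul_of_nonneg_left m1 hRpos.le
    have a2 : Rmin * y ≤ (Rn (N k) - r) * y := mul_le_mul_of_nonneg_right h2 m2
    have a3 : r * (t (k+1) - t k - L (N k)) ≤ r * y := mul_le_mul_of_nonneg_left m1 hr0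
    linarith
  have htot := Finset.sum_le_sum (fun k hk => hnode k (Finset.mem_range.1 hk))
  rw [Finset.sum_add_distrib, htele, Finset.sum_sub_distrib, ← Finset.mul_sum,
    Finset.sum_sub_distrib, Finset.sum_range_sub, htn, Finset.sum_comm (t := K),
    Finset.sum_comm (t := K), ← hsum] at htot
  have hflows := Finset.sum_le_sum hflow
  have hLi : ∀ i, ∑ k ∈ Finset.range (m+1), (if N k ∈ path i then ρ i * L (N k) else 0) =
      ρ i * ∑ j ∈ subpath ∩ path i, L j := by
    intro i
    rw [← hsum (fun v => if v ∈ path i then ρ i * L v else 0), ← Finset.sum_filter,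
      Finset.filter_mem_eq_inter, Finset.mul_sum]
  simp only [hLi] at htot
  have hT : Rmin * Ttot = Rmin * (∑ k ∈ subpath, L k) +
      (∑ i ∈ K, ((if first f ∈ path i ∧ first i ≠ first f then σp i else 0) +
         (if first i ∈ subpath then σ0 i else 0)) + ∑ i ∈ K, ρ i * ∑ j ∈ subpath ∩ path i, L j) := by
    rw [hTtot, ← Finset.sum_div, mul_add, mul_div_cancel₀ _ hRpos.ne']
    congr 1
    exact Finset.sum_add_distrib ..
  have hmain : F f (first f) (t 0) + Rmin * (t0 - t 0 - Ttot) ≤ Fs f (N m) t0 := by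
    linarith
  have hmono : F f (first f) (t 0) ≤ Fs f (N m) t0 := by
    have : 0 ≤ Fs f (N m) t0 - F f (first f) (t 0) := by
      rw [← htele]
      apply Finset.sum_nonneg
      intro k hk
      have hk := Finset.mem_range.1 hk
      rw [heq k hk f (hNf k hk) le_rfl]
      exact sub_nonneg.2 ((hFscum f le_rfl _ (hNf k hk)).1.1 (htk k hk).2.1)
    linarith
  have htle : t 0 ≤ t0 := by
    have : 0 ≤ t (m+1) - t 0 := by
      rw [← Finset.sum_range_sub]
      exact Finset.sum_nonneg fun k hk => sub_nonneg.2 (htk k (Finset.mem_range.1 hk)).2.1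
    linarith
  have hcum := (hFcum f le_rfl _ (hN0 ▸ hNf 0 (by omega))).1
  have hfin : F f (first f) (t 0) + rateLatency Rmin Ttot (t0 - t 0) ≤ Fs f (N m) t0 := by
    unfold rateLatency
    rcases max_cases (t0 - t 0 - Ttot) 0 with ⟨h, _⟩ | ⟨h, _⟩ <;> rw [h]
    · exact hmain
    · linarith
  refine le_trans (csInf_le ?_ ?_) hfin
  swap
  · exact ⟨t 0, ⟨ht00, htle⟩, rfl⟩
  refine ⟨0, ?_⟩
  rintro _ ⟨s, hs, rfl⟩
  have h1 : 0 ≤ F f (first f) s := by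
    rw [← hcum.2 0 le_rfl]; exact hcum.1 hs.1
  exact add_nonneg h1 (mul_nonneg hRpos.le (le_max_right _ _))
end

section
/- Let σ ≥ 0, T ≥ 0 and 0 ≤ ρ ≤ R with R > 0. Let F and F* be cumulative functions with F* ≤ F pointwise, suppose F admits the leaky-bucket arrival curve α_{σ,ρ}(u) = σ + ρ·u (for u ≥ 0), and suppose the system offers to F the simple service curve β_{R,T}(u) = R·max(u − T, 0) with output F*. Then for every t ≥ 0 the virtual delay satisfies d(t) ≤ σ/R + T. -/
/-- The virtual delay at time `t`: `d(t) = inf {τ ≥ 0 : F t ≤ Fs (t + τ)}`. -/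
noncomputable def virtualDelay (F Fs : ℝ → ℝ) (t : ℝ) : ℝ :=
  sInf {τ : ℝ | 0 ≤ τ ∧ F t ≤ Fs (t + τ)}

/-- Delay bound `σ/R + T` for a `(σ, ρ)`-leaky-bucket constrained flow served by a
rate-latency service curve `β_{R,T}`. -/
theorem delay_bound_leakyBucket_rateLatency
    (σ ρ R T : ℝ) (hσ : 0 ≤ σ) (hT : 0 ≤ T) (hρ : 0 ≤ ρ) (hρR : ρ ≤ R) (hR : 0 < R)
    (F Fs : ℝ → ℝ)
    (hF : Cumulative F) (hFs : Cumulative Fs)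
    (hle : ∀ t : ℝ, Fs t ≤ F t)
    (harr : ArrivalCurve (leakyBucket σ ρ) F)
    (hserv : OffersSimple F Fs (rateLatency R T)) :
    ∀ t : ℝ, 0 ≤ t → virtualDelay F Fs t ≤ σ / R + T := by
  intro t ht
  have hq : 0 ≤ σ / R := div_nonneg hσ hR.le
  have hqR : R * (σ / R) = σ := by field_simp
  unfold virtualDelay
  refine csInf_le ⟨0, fun x hx => hx.1⟩ ⟨by linarith, ?_⟩
  refine le_trans ?_ (hserv (t + (σ / R + T)) (by linarith))
  refine le_csInf ((Set.nonempty_Icc.2 (by linarith)).image _) ?_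
  rintro _ ⟨s, ⟨hs0, hs⟩, rfl⟩
  simp only [rateLatency]
  rcases le_total s t with h | h
  · have h1 := harr s t hs0 h
    simp only [leakyBucket] at h1
    have h2 : ρ * (t - s) ≤ R * (t - s) :=
      mul_le_mul_of_nonneg_right hρR (by linarith)
    have h3 : R * (t + (σ / R + T) - s - T) ≤ R * max (t + (σ / R + T) - s - T) 0 :=
      mul_le_mul_of_nonneg_left (le_max_left _ _) hR.le
    have h4 : R * (t + (σ / R + T) - s - T) = R * (t - s) + R * (σ / R) := by ring
    linarith
  · have h1 := hF.1 h
    have h2 : 0 ≤ R * max (t + (σ / R + T) - s - T) 0 :=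
      mul_nonneg hR.le (le_max_right _ _)
    linarith
end

section
/- Let σ ≥ 0, T ≥ 0 and 0 ≤ ρ ≤ R with R > 0. Let F and F* be cumulative functions with F* ≤ F pointwise, suppose F admits the leaky-bucket arrival curve α_{σ,ρ}(u) = σ + ρ·u (for u ≥ 0), and suppose the system offers to F the simple service curve β_{R,T}(u) = R·max(u − T, 0) with output F*. Then for every t ≥ 0 the backlog satisfies F(t) − F*(t) ≤ σ + ρ·T. -/
/-- Backlog bound `σ + ρ·T` for a `(σ, ρ)`-leaky-bucket constrained flow served by a
rate-latency service curve `β_{R,T}`. -/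
theorem backlog_bound_leakyBucket_rateLatency
    (σ ρ R T : ℝ) (hσ : 0 ≤ σ) (hT : 0 ≤ T) (hρ : 0 ≤ ρ) (hρR : ρ ≤ R) (hR : 0 < R)
    (F Fs : ℝ → ℝ)
    (hF : Cumulative F) (hFs : Cumulative Fs)
    (hle : ∀ t : ℝ, Fs t ≤ F t)
    (harr : ArrivalCurve (leakyBucket σ ρ) F)
    (hserv : OffersSimple F Fs (rateLatency R T)) :
    ∀ t : ℝ, 0 ≤ t → F t - Fs t ≤ σ + ρ * T := by
  intro t ht
  have h1 := hserv t ht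
  have h2 : F t - σ - ρ * T ≤ sInf ((fun s => F s + rateLatency R T (t - s)) '' Set.Icc 0 t) := by
    apply le_csInf
    · exact ⟨_, 0, ⟨le_refl _, ht⟩, rfl⟩
    · rintro _ ⟨s, ⟨hs0, hst⟩, rfl⟩
      have h3 := harr s t hs0 hst
      simp only [leakyBucket, rateLatency] at h3 ⊢
      have h4 : ρ * (t - s - T) ≤ ρ * max (t - s - T) 0 :=
        mul_le_mul_of_nonneg_left (le_max_left _ _) hρ
      have h5 : ρ * max (t - s - T) 0 ≤ R * max (t - s - T) 0 :=
        mul_le_mul_of_nonneg_right hρR (le_max_right _ _)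
      have h6 : ρ * (t - s - T) = ρ * (t - s) - ρ * T := by ring
      linarith
  linarith
end

section
/- Let F and F* be continuous cumulative functions with F* ≤ F pointwise and F(0) = F*(0) = 0, and suppose the system offers the strict service curve β to F (with output F*), where β(0) ≤ 0. Then for every t ≥ 0 there exists s ∈ [0, t] (the start of the backlogged period containing t) such that F(s) = F*(s) and F*(t) − F*(s) ≥ β(t − s). -/
/-- Start-of-backlogged-period property: under a strict service curve `β` with
`β 0 ≤ 0`, for every `t ≥ 0` there is `s ∈ [0, t]` with `F s = Fs s` and
`Fs t - Fs s ≥ β (t - s)`. -/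
theorem exists_start_of_backlogged_period
    (F Fs β : ℝ → ℝ)
    (hF : Cumulative F) (hFs : Cumulative Fs)
    (hFc : Continuous F) (hFsc : Continuous Fs)
    (hle : ∀ t : ℝ, Fs t ≤ F t)
    (hF0 : F 0 = 0) (hFs0 : Fs 0 = 0)
    (hstrict : OffersStrict F Fs β)
    (hβ0 : β 0 ≤ 0) :
    ∀ t : ℝ, 0 ≤ t → ∃ s : ℝ, 0 ≤ s ∧ s ≤ t ∧ F s = Fs s ∧
      β (t - s) ≤ Fs t - Fs s := by
  intro t ht
  have hcomp : IsCompact (Set.Icc 0 t ∩ {s | F s = Fs s}) :=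
    isCompact_Icc.inter_right (isClosed_eq hFc hFsc)
  obtain ⟨s, ⟨⟨hs0, hst⟩, hs⟩, hmax⟩ := hcomp.exists_isGreatest
    ⟨0, ⟨le_refl 0, ht⟩, by simp [hF0, hFs0]⟩
  refine ⟨s, hs0, hst, hs, ?_⟩
  rcases hst.eq_or_lt with h | h
  · subst h
    simpa using hβ0
  · refine hstrict s t ⟨h, fun u hu hut => lt_of_le_of_ne (hle u) fun he => ?_⟩
    exact absurd (hmax ⟨⟨hs0.trans hu.le, hut⟩, he.symm⟩) (not_le.mpr hu)
end
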